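/- Let Γ ⊂ P^n, n ≥ 2, be a finite subscheme of degree d in linearly general position over an algebraically closed field of characteristic 0 such that d ≥ 4n² + 6n + 1 and reg(Γ) ≥ ⌈(d−1)/(n + n/(2n+2))⌉ + 3. Set m := ⌈(d−1)/n⌉ + 1 − reg(Γ). Then ρ(Γ) > d − (m+1)n. -/

import Mathlib

open MvPolynomial Filter
open scoped Classical

attribute [local instance] MvPolynomial.gradedAlgebra

noncomputable section

variable {K : Type} [Field K] {n : ℕ}

/-- The Hilbert function, in degree `m`, of the quotient of the homogeneous
coordinate ring of `ℙ^n_K` by the ideal `I`. -/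
def hilbF (I : Ideal (MvPolynomial (Fin (n+1)) K)) (m : ℕ) : ℕ :=
  Module.finrank K
    ((MvPolynomial.homogeneousSubmodule (Fin (n+1)) K m).map
      (Ideal.Quotient.mkₐ K I).toLinearMap)

/-- The irrelevant maximal ideal `(x_0, …, x_n)`. -/
def irrelevantIdeal (K : Type) [Field K] (n : ℕ) : Ideal (MvPolynomial (Fin (n+1)) K) :=
  Ideal.span (Set.range MvPolynomial.X)

/-- Saturation of a homogeneous ideal with respect to the irrelevant ideal. -/
def saturate (I : Ideal (MvPolynomial (Fin (n+1)) K)) : Ideal (MvPolynomial (Fin (n+1)) K) :=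
  ⨆ k : ℕ, Submodule.colon I ((irrelevantIdeal K n ^ k : Ideal (MvPolynomial (Fin (n+1)) K)) : Submodule (MvPolynomial (Fin (n+1)) K) (MvPolynomial (Fin (n+1)) K))

/-- `I` is the (saturated, homogeneous) ideal of a nonempty finite closed subscheme of
`ℙ^n`, i.e. its Hilbert function is eventually a positive constant. -/
structure IsFiniteSubscheme (I : Ideal (MvPolynomial (Fin (n+1)) K)) : Prop where
  homog : Ideal.IsHomogeneous (MvPolynomial.homogeneousSubmodule (Fin (n+1)) K) I
  saturated : saturate I = I
  finite : ∃ d : ℕ, 0 < d ∧ ∀ᶠ m : ℕ in atTop, hilbF I m = d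

/-- The degree (length) of the finite scheme with ideal `I` : the eventual value of
its Hilbert function. -/
def schemeDeg (I : Ideal (MvPolynomial (Fin (n+1)) K)) : ℕ :=
  if h : ∃ d : ℕ, ∀ᶠ m : ℕ in atTop, hilbF I m = d then h.choose else 0

/-- The Castelnuovo–Mumford regularity of the finite scheme with ideal `I` : the least
`p ≥ 1` such that the scheme is `(p-1)`-normal (for a finite scheme, `p`-regularity is
equivalent to `(p-1)`-normality). -/
def schemeReg (I : Ideal (MvPolynomial (Fin (n+1)) K)) : ℕ :=
  sInf {p : ℕ | 1 ≤ p ∧ ∀ m : ℕ, p - 1 ≤ m → hilbF I m = schemeDeg I}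

/-- `h¹(ℙ^n, I_Γ(q))` for a finite scheme `Γ` and `q ≥ 0`: the failure of `q`-normality,
`deg Γ - h_Γ(q)`. -/
def h1F (I : Ideal (MvPolynomial (Fin (n+1)) K)) (q : ℕ) : ℕ :=
  schemeDeg I - hilbF I q

/-- `J` is the ideal of a `t`-dimensional linear subspace of `ℙ^n`: it is generated by a
space of linear forms of codimension... i.e. of `K`-dimension `n - t`. -/
def IsLinearSubspace (J : Ideal (MvPolynomial (Fin (n+1)) K)) (t : ℕ) : Prop :=
  ∃ W : Submodule K (MvPolynomial (Fin (n+1)) K),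
    W ≤ MvPolynomial.homogeneousSubmodule (Fin (n+1)) K 1 ∧
    Module.finrank K W + t = n ∧
    J = Ideal.span (W : Set (MvPolynomial (Fin (n+1)) K))

/-- The ideal of the scheme-theoretic intersection (defined by the sum of the ideal
sheaves): the saturation of `I + J`. -/
def interIdeal (I J : Ideal (MvPolynomial (Fin (n+1)) K)) : Ideal (MvPolynomial (Fin (n+1)) K) :=
  saturate (I ⊔ J)

/-- The residual scheme `Γ : V`, where `V` is the hypersurface `{f = 0}`, is defined by
the colon ideal `(I_Γ : f)`. -/
def residualIdeal (I : Ideal (MvPolynomial (Fin (n+1)) K)) (f : MvPolynomial (Fin (n+1)) K) :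
    Ideal (MvPolynomial (Fin (n+1)) K) :=
  Submodule.colon I (Ideal.span {f})

/-- `Γ` admits a `(t+2)`-secant `t`-plane. -/
def HasSecantPlane (I : Ideal (MvPolynomial (Fin (n+1)) K)) (t : ℕ) : Prop :=
  ∃ J : Ideal (MvPolynomial (Fin (n+1)) K),
    IsLinearSubspace J t ∧ t + 2 ≤ schemeDeg (interIdeal I J)

/-- `t(Γ)`: the smallest `t` such that `Γ` admits a `(t+2)`-secant `t`-plane. -/
def tInv (I : Ideal (MvPolynomial (Fin (n+1)) K)) : ℕ :=
  sInf {t : ℕ | HasSecantPlane I t}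

/-- `Γ` is in linearly general position if `t(Γ) = n`. -/
def InLinGenPos (I : Ideal (MvPolynomial (Fin (n+1)) K)) : Prop :=
  tInv I = n

/-- `Γ ⊆ ℙ^n` is nondegenerate: `I(Γ)` contains no nonzero linear form. -/
def NondegenerateScheme (I : Ideal (MvPolynomial (Fin (n+1)) K)) : Prop :=
  Submodule.restrictScalars K I ⊓ MvPolynomial.homogeneousSubmodule (Fin (n+1)) K 1 = ⊥

/-- The (projective) dimension of the linear span `⟨Γ⟩` of the scheme with ideal `I`:
`n` minus the number of independent linear forms in `I`. -/
def spanDim (I : Ideal (MvPolynomial (Fin (n+1)) K)) : ℕ :=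
  n - Module.finrank K
    ↥(Submodule.restrictScalars K I ⊓ MvPolynomial.homogeneousSubmodule (Fin (n+1)) K 1)

/-- `Γ ∩ Λ` is nondegenerate as a subscheme of the `t`-plane `Λ`: it is contained in no
`(t-1)`-dimensional linear subspace of `Λ`. -/
def NondegenerateIn (I Λ : Ideal (MvPolynomial (Fin (n+1)) K)) (t : ℕ) : Prop :=
  ∀ J : Ideal (MvPolynomial (Fin (n+1)) K),
    IsLinearSubspace J (t - 1) → Λ ≤ J → ¬ J ≤ interIdeal I Λ

/-- `Γ ∩ Λ` is in linearly general position as a subscheme of the `t`-plane `Λ`: it has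
no `(s+2)`-secant `s`-plane inside `Λ` for any `s < t`. -/
def InLinGenPosIn (I Λ : Ideal (MvPolynomial (Fin (n+1)) K)) (t : ℕ) : Prop :=
  ∀ s : ℕ, s < t → ∀ J : Ideal (MvPolynomial (Fin (n+1)) K),
    IsLinearSubspace J s → Λ ≤ J → schemeDeg (interIdeal I J) ≤ s + 1

/-- `J` is the (saturated) homogeneous ideal of a rational normal curve of degree `t`
in `ℙ^n` : the curve is the image of `ℙ^1` under a parametrization by a basis-spanning
family of binary forms of degree `t`, and `J` is the vanishing ideal of (the affine cone
over) this image. -/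
def IsRNC (t : ℕ) (J : Ideal (MvPolynomial (Fin (n+1)) K)) : Prop :=
  ∃ p : Fin (n+1) → MvPolynomial (Fin 2) K,
    (∀ i, (p i).IsHomogeneous t) ∧
    Submodule.span K (Set.range p) = MvPolynomial.homogeneousSubmodule (Fin 2) K t ∧
    J = ⨅ x : Fin 2 → K,
      RingHom.ker (MvPolynomial.eval (fun i => MvPolynomial.eval x (p i)) :
        MvPolynomial (Fin (n+1)) K →+* K)

/-- `ρ(Γ)`: the maximal length of the intersection of `Γ` with a rational normal curve
(of degree `n`) in `ℙ^n`. -/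
def rhoInv (I : Ideal (MvPolynomial (Fin (n+1)) K)) : ℕ :=
  sSup {e : ℕ | ∃ J : Ideal (MvPolynomial (Fin (n+1)) K),
    IsRNC n J ∧ e = schemeDeg (interIdeal I J)}

/-- The (saturated homogeneous) vanishing ideal of a point of `ℙ^n`. -/
def pointIdeal (P : Projectivization K (Fin (n+1) → K)) : Ideal (MvPolynomial (Fin (n+1)) K) :=
  ⨅ c : K, RingHom.ker
    (MvPolynomial.eval (c • P.rep) : MvPolynomial (Fin (n+1)) K →+* K)

/-- The vanishing ideal of a finite set of points of `ℙ^n`. -/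
def idealOfFinset (S : Finset (Projectivization K (Fin (n+1) → K))) :
    Ideal (MvPolynomial (Fin (n+1)) K) :=
  ⨅ P ∈ S, pointIdeal P

/-- A finite set of points of `ℙ^n` is in uniform position if every subset `Y` has
Hilbert function `h_Y(ℓ) = min {|Y|, h_Γ(ℓ)}`. -/
def UniformPosition (S : Finset (Projectivization K (Fin (n+1) → K))) : Prop :=
  ∀ Y ⊆ S, ∀ ℓ : ℕ, hilbF (idealOfFinset Y) ℓ = min Y.card (hilbF (idealOfFinset S) ℓ)

end

section FiniteAlgebra

variable {K : Type} [Field K] {A : Type} [CommRing A] [Algebra K A]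

lemma finrank_map_mkQ_add {M : Type} [AddCommGroup M] [Module K M] [FiniteDimensional K M]
    (N U : Submodule K M) :
    Module.finrank K (U.map N.mkQ) + Module.finrank K ↥(U ⊓ N) = Module.finrank K U := by
  have h := (N.mkQ.domRestrict U).finrank_range_add_finrank_ker
  rw [LinearMap.range_domRestrict, LinearMap.ker_domRestrict, Submodule.ker_mkQ] at h
  have e : Module.finrank K (N.comap U.subtype) = Module.finrank K ↥(U ⊓ N) := by
    rw [← Submodule.map_comap_subtype, Submodule.finrank_map_subtype_eq]
  rwa [← e]

lemma finrank_quotient_add_finrank_ideal [FiniteDimensional K A] (B : Ideal A) :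
    Module.finrank K (A ⧸ B) + Module.finrank K (B.restrictScalars K) = Module.finrank K A := by
  rw [← (B.restrictScalars K).finrank_quotient_add_finrank]
  congr 1

/-- The largest ideal contained in the kernel of a linear functional. -/
def annF (φ : A →ₗ[K] K) : Ideal A where
  carrier := {a | ∀ b, φ (a * b) = 0}
  zero_mem' := by simp
  add_mem' := by
    intro a b ha hb c
    rw [add_mul, map_add, ha c, hb c, add_zero]
  smul_mem' := by
    intro c a ha b
    rw [smul_eq_mul, mul_comm c a, mul_assoc]
    exact ha _

/-- The functional `b ↦ φ (f * b)`. -/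
def twist (f : A) (φ : A →ₗ[K] K) : A →ₗ[K] K := φ ∘ₗ LinearMap.mulLeft K f

lemma mem_annF {φ : A →ₗ[K] K} {a : A} : a ∈ annF φ ↔ ∀ b, φ (a * b) = 0 := Iff.rfl

lemma twist_apply (f : A) (φ : A →ₗ[K] K) (b : A) : twist f φ b = φ (f * b) := rfl

lemma mem_annF_twist {φ : A →ₗ[K] K} {f a : A} : a ∈ annF (twist f φ) ↔ f * a ∈ annF φ := by
  simp only [mem_annF, twist_apply, mul_assoc]

lemma twist_eq_zero_iff {φ : A →ₗ[K] K} {f : A} : twist f φ = 0 ↔ f ∈ annF φ := by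
  simp only [mem_annF, LinearMap.ext_iff, twist_apply, LinearMap.zero_apply]

lemma annF_le_annF_twist (f : A) (φ : A →ₗ[K] K) : annF φ ≤ annF (twist f φ) :=
  fun _ ha => mem_annF_twist.2 (Ideal.mul_mem_left _ _ ha)

lemma apply_eq_zero_of_mem_annF {φ : A →ₗ[K] K} {a : A} (ha : a ∈ annF φ) : φ a = 0 := by
  simpa using ha 1

lemma twist_pow_le_ker {V : Submodule K A} {φ : A →ₗ[K] K} {f : A} {j k : ℕ} (hf : f ∈ V ^ j)
    (h : V ^ (j + k) ≤ LinearMap.ker φ) : V ^ k ≤ LinearMap.ker (twist f φ) := by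
  intro b hb
  have : f * b ∈ V ^ (j + k) := by
    rw [pow_add]; exact Submodule.mul_mem_mul hf hb
  exact h this

variable [FiniteDimensional K A]

/-- Residuation: the lengths of the residual scheme and of the section add up. -/
lemma finrank_residual (φ : A →ₗ[K] K) (f : A) :
    Module.finrank K (A ⧸ annF (twist f φ)) + Module.finrank K (A ⧸ (annF φ ⊔ Ideal.span {f})) =
      Module.finrank K (A ⧸ annF φ) := by
  set N := annF φ
  have h1 := finrank_quotient_add_finrank_ideal (K := K) (annF (twist f φ))
  have h2 := finrank_quotient_add_finrank_ideal (K := K) (N ⊔ Ideal.span {f})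
  have h3 := finrank_quotient_add_finrank_ideal (K := K) N
  have h4 := finrank_map_mkQ_add (N.restrictScalars K) ((N ⊔ Ideal.span {f}).restrictScalars K)
  have e1 : (N ⊔ Ideal.span {f}).restrictScalars K ⊓ N.restrictScalars K = N.restrictScalars K :=
    inf_eq_right.2 fun x hx => (le_sup_left : N ≤ N ⊔ Ideal.span {f}) hx
  rw [e1] at h4
  have h5 := ((N.restrictScalars K).mkQ ∘ₗ LinearMap.mulLeft K f).finrank_range_add_finrank_ker
  have e2 : LinearMap.ker ((N.restrictScalars K).mkQ ∘ₗ LinearMap.mulLeft K f) =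
      (annF (twist f φ)).restrictScalars K := by
    ext x
    simp only [LinearMap.mem_ker, LinearMap.comp_apply, Submodule.mkQ_apply,
      Submodule.Quotient.mk_eq_zero, Submodule.restrictScalars_mem, LinearMap.mulLeft_apply]
    exact mem_annF_twist.symm
  have e3 : LinearMap.range ((N.restrictScalars K).mkQ ∘ₗ LinearMap.mulLeft K f) =
      ((N ⊔ Ideal.span {f}).restrictScalars K).map (N.restrictScalars K).mkQ := by
    ext y
    constructor
    · rintro ⟨x, rfl⟩
      exact ⟨f * x, Ideal.mul_mem_right _ _ (Ideal.mem_sup_right (Ideal.mem_span_singleton_self f)),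
        rfl⟩
    · rintro ⟨x, hx, rfl⟩
      obtain ⟨u, hu, w, hw, rfl⟩ := Submodule.mem_sup.1 hx
      obtain ⟨c, rfl⟩ := Ideal.mem_span_singleton'.1 hw
      refine ⟨c, ?_⟩
      simp only [LinearMap.comp_apply, Submodule.mkQ_apply, LinearMap.mulLeft_apply]
      refine (Submodule.Quotient.eq _).2 ?_
      have : f * c - (u + c * f) = -u := by ring
      rw [this]
      exact (N.restrictScalars K).neg_mem hu
  rw [e2, e3] at h5
  omega

/-- Finite-dimensional quotients of a commutative algebra over an algebraically closed field
have quotients of every smaller dimension. -/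
lemma exists_ideal_finrank_quotient_eq [IsAlgClosed K] (N : Ideal A) {c : ℕ}
    (hc : c ≤ Module.finrank K (A ⧸ N)) :
    ∃ B : Ideal A, N ≤ B ∧ Module.finrank K (A ⧸ B) = c := by
  obtain ⟨j, hj⟩ := Nat.exists_eq_add_of_le hc
  clear hc
  induction j generalizing N with
  | zero => exact ⟨N, le_rfl, hj⟩
  | succ j ih =>
    have : Nontrivial (A ⧸ N) := Module.nontrivial_of_finrank_pos (R := K) (by omega)
    have : IsArtinianRing A := IsArtinianRing.of_finite K A
    obtain ⟨a, ha⟩ := IsAtomic.exists_atom (Submodule A (A ⧸ N))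
    have hs : IsSimpleModule A a := isSimpleModule_iff_isAtom.2 ha
    obtain ⟨P, hP, ⟨e⟩⟩ := isSimpleModule_iff_quot_maximal.1 hs
    have hb : Function.Bijective (algebraMap K (A ⧸ P)) :=
      IsAlgClosed.algebraMap_bijective_of_isIntegral
    have h1 : Module.finrank K (A ⧸ P) = 1 := by
      rw [← Module.finrank_self K]
      exact (LinearEquiv.ofBijective (Algebra.linearMap K (A ⧸ P)) hb).finrank_eq.symm
    have h2 : Module.finrank K (a.restrictScalars K) = 1 := by
      rw [← h1]; exact (e.restrictScalars K).finrank_eq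
    set B : Ideal A := a.comap N.mkQ
    have hNB : N ≤ B := by
      intro x hx
      change N.mkQ x ∈ a
      rw [Submodule.mkQ_apply, (Submodule.Quotient.mk_eq_zero N).2 hx]
      exact a.zero_mem
    have h3 := finrank_quotient_add_finrank_ideal (K := K) B
    have h4 := finrank_quotient_add_finrank_ideal (K := K) N
    have h5 := finrank_map_mkQ_add (N.restrictScalars K) (B.restrictScalars K)
    rw [inf_eq_right.2 (show N.restrictScalars K ≤ B.restrictScalars K from hNB)] at h5
    have h6 : Module.finrank K ((B.restrictScalars K).map (N.restrictScalars K).mkQ) = 1 := by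
      rw [← h2]
      have : (B.restrictScalars K).map (N.restrictScalars K).mkQ =
          (a.restrictScalars K : Submodule K (A ⧸ N)) := by
        ext y
        constructor
        · rintro ⟨x, hx, rfl⟩
          exact hx
        · intro hy
          obtain ⟨x, rfl⟩ := N.mkQ_surjective y
          exact ⟨x, hy, rfl⟩
      rw [this]
      rfl
    obtain ⟨B', hB', h⟩ := ih B (by omega)
    exact ⟨B', hNB.trans hB', h⟩

end FiniteAlgebra

/-- Algebraic form of linearly general position: `A` is the coordinate ring of a finite scheme in
an affine chart of `ℙ^n` and `V` is spanned by the coordinates and `1`. -/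
structure IsLGP {K : Type} [Field K] {A : Type} [CommRing A] [Algebra K A]
    (V : Submodule K A) (n : ℕ) : Prop where
  one_mem : 1 ∈ V
  finrank_eq : Module.finrank K V = n + 1
  bot_or_top : ∀ B : Ideal A,
    V ⊓ B.restrictScalars K = ⊥ ∨ V ⊔ B.restrictScalars K = ⊤

section IsLGP

variable {K : Type} [Field K] {A : Type} [CommRing A] [Algebra K A] {V : Submodule K A} {n : ℕ}

lemma IsLGP.pow_mono (h : IsLGP V n) {i j : ℕ} (hij : i ≤ j) : V ^ i ≤ V ^ j :=
  pow_le_pow_right' (Submodule.one_le.2 h.one_mem) hij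

lemma IsLGP.le_pow (h : IsLGP V n) {k : ℕ} (hk : 1 ≤ k) : V ≤ V ^ k := by
  simpa using h.pow_mono hk

lemma eq_zero_of_sup_annF_eq_top {φ : A →ₗ[K] K} (hV : V ≤ LinearMap.ker φ)
    (h : V ⊔ (annF φ).restrictScalars K = ⊤) : φ = 0 := by
  rw [← LinearMap.ker_eq_top, ← top_le_iff, ← h]
  exact sup_le hV fun a ha => apply_eq_zero_of_mem_annF ha

lemma IsLGP.inf_annF (h : IsLGP V n) {φ : A →ₗ[K] K} (hφ : φ ≠ 0) {k : ℕ} (hk : 1 ≤ k)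
    (hV : V ^ k ≤ LinearMap.ker φ) : V ⊓ (annF φ).restrictScalars K = ⊥ :=
  (h.bot_or_top (annF φ)).resolve_right fun h' =>
    hφ (eq_zero_of_sup_annF_eq_top ((h.le_pow hk).trans hV) h')

lemma IsLGP.notMem_annF (h : IsLGP V n) {φ : A →ₗ[K] K} (hφ : φ ≠ 0) {k : ℕ} (hk : 1 ≤ k)
    (hV : V ^ k ≤ LinearMap.ker φ) {a : A} (ha : a ∈ V) (ha0 : a ≠ 0) : a ∉ annF φ := by
  intro ha'
  have : a ∈ V ⊓ (annF φ).restrictScalars K := ⟨ha, ha'⟩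
  rw [h.inf_annF hφ hk hV] at this
  exact ha0 this

variable [FiniteDimensional K A]

lemma exists_mem_of_finrank_inf_lt {U N B : Submodule K A}
    (h : Module.finrank K ↥(U ⊓ N) < Module.finrank K ↥(U ⊓ B)) : ∃ f ∈ U, f ∈ B ∧ f ∉ N := by
  by_contra! H
  exact absurd (Submodule.finrank_mono (R := K) (show U ⊓ B ≤ U ⊓ N from
    fun x hx => ⟨hx.1, H x hx.1 hx.2⟩)) (not_le.2 h)

lemma finrank_le_finrank_inf_add (U : Submodule K A) (B : Ideal A) :
    Module.finrank K U ≤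
      Module.finrank K ↥(U ⊓ B.restrictScalars K) + Module.finrank K (A ⧸ B) := by
  have h1 := Submodule.finrank_sup_add_finrank_inf_eq U (B.restrictScalars K)
  have h2 := finrank_quotient_add_finrank_ideal (K := K) B
  have h3 := (U ⊔ B.restrictScalars K).finrank_le
  omega

lemma finrank_quotient_le_of_le {N B : Ideal A} (h : N ≤ B) :
    Module.finrank K (A ⧸ B) ≤ Module.finrank K (A ⧸ N) := by
  have h1 := finrank_quotient_add_finrank_ideal (K := K) B
  have h2 := finrank_quotient_add_finrank_ideal (K := K) N
  have h3 := Submodule.finrank_mono (R := K) (show N.restrictScalars K ≤ B.restrictScalars K from h)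
  omega

/-- Schemes in linearly general position failing to impose independent conditions in degree `k`
have length at least `n * k + 2`. -/
lemma IsLGP.le_finrank [IsAlgClosed K] (h : IsLGP V n) {k : ℕ} {φ : A →ₗ[K] K} (hφ : φ ≠ 0)
    (hV : V ^ k ≤ LinearMap.ker φ) : n * k + 2 ≤ Module.finrank K (A ⧸ annF φ) := by
  induction k generalizing φ with
  | zero =>
    by_contra! hlt
    have h1 : (1 : A) ∉ annF φ := by
      intro h1
      exact hφ (LinearMap.ext fun b => by simpa using h1 b)
    have h2 : φ 1 = 0 := hV (by rw [pow_zero]; exact Submodule.one_le.1 le_rfl)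
    have h3 := finrank_quotient_add_finrank_ideal (K := K) (annF φ)
    have h4 : Submodule.span K {(1 : A)} ⊓ (annF φ).restrictScalars K = ⊥ := by
      rw [eq_bot_iff]
      rintro x ⟨hx, hx'⟩
      obtain ⟨c, rfl⟩ := Submodule.mem_span_singleton.1 hx
      by_cases hc : c = 0
      · simp [hc]
      · refine absurd ?_ h1
        have : c⁻¹ • c • (1 : A) ∈ (annF φ).restrictScalars K := Submodule.smul_mem _ _ hx'
        rwa [smul_smul, inv_mul_cancel₀ hc, one_smul] at this
    have h5 := Submodule.finrank_sup_add_finrank_inf_eq (Submodule.span K {(1 : A)})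
      ((annF φ).restrictScalars K)
    have h10 : (1 : A) ≠ 0 := fun h0 => h1 (h0 ▸ Ideal.zero_mem _)
    rw [h4, finrank_bot, finrank_span_singleton h10] at h5
    refine hφ (eq_zero_of_sup_annF_eq_top (V := Submodule.span K {(1 : A)}) ?_ ?_)
    · rw [Submodule.span_le]
      rintro _ rfl
      exact h2
    · apply Submodule.eq_top_of_finrank_eq
      have := (Submodule.span K {(1 : A)} ⊔ (annF φ).restrictScalars K).finrank_le
      omega
  | succ k ih =>
    have h1 := h.inf_annF hφ (Nat.succ_pos k) hV
    have h2 := finrank_le_finrank_inf_add V (annF φ)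
    rw [h1, finrank_bot, h.finrank_eq] at h2
    obtain ⟨B, hB, hBn⟩ := exists_ideal_finrank_quotient_eq (K := K) (annF φ) (c := n) (by omega)
    have h3 := finrank_le_finrank_inf_add V B
    rw [h.finrank_eq, hBn] at h3
    obtain ⟨f, hfV, hfB, hfN⟩ := exists_mem_of_finrank_inf_lt (U := V)
      (N := (annF φ).restrictScalars K) (B := B.restrictScalars K)
      (by rw [h1, finrank_bot]; omega)
    have h4 : n * k + 2 ≤ _ := ih (φ := twist f φ) (fun h0 => hfN (twist_eq_zero_iff.1 h0))
      (twist_pow_le_ker (j := 1) (by simpa using hfV) (by rwa [add_comm]))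
    have h5 := finrank_residual φ f
    have h6 := finrank_quotient_le_of_le (K := K) (N := annF φ ⊔ Ideal.span {f}) (B := B)
      (sup_le hB ((Ideal.span_singleton_le_iff_mem _).2 hfB))
    rw [mul_add]
    omega

/-- If the quadrics impose at least `2n + 2` conditions, some quadric removes at least `2n + 1`
points but not all of them. -/
lemma exists_quadric [IsAlgClosed K] {φ : A →ₗ[K] K}
    (h : Module.finrank K ↥(V ^ 2 ⊓ (annF φ).restrictScalars K) + (2 * n + 2) ≤
      Module.finrank K ↥(V ^ 2)) :
    ∃ f ∈ V ^ 2, twist f φ ≠ 0 ∧ Module.finrank K (A ⧸ annF (twist f φ)) + (2 * n + 1) ≤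
      Module.finrank K (A ⧸ annF φ) := by
  have h2 := finrank_le_finrank_inf_add (V ^ 2) (annF φ)
  obtain ⟨B, hB, hBn⟩ := exists_ideal_finrank_quotient_eq (K := K) (annF φ) (c := 2 * n + 1)
    (by omega)
  have h3 := finrank_le_finrank_inf_add (V ^ 2) B
  obtain ⟨f, hfV, hfB, hfN⟩ := exists_mem_of_finrank_inf_lt (U := V ^ 2)
    (N := (annF φ).restrictScalars K) (B := B.restrictScalars K) (by omega)
  refine ⟨f, hfV, fun h0 => hfN (twist_eq_zero_iff.1 h0), ?_⟩
  have h5 := finrank_residual φ f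
  have h6 := finrank_quotient_le_of_le (K := K) (N := annF φ ⊔ Ideal.span {f}) (B := B)
    (sup_le hB ((Ideal.span_singleton_le_iff_mem _).2 hfB))
  omega

/-- Repeatedly removing quadric sections reaches a residual scheme imposing at most `2n + 1`
conditions on quadrics. -/
lemma IsLGP.exists_residual [IsAlgClosed K] (h : IsLGP V n) {q : ℕ} {φ : A →ₗ[K] K} (hφ : φ ≠ 0)
    (hV : V ^ q ≤ LinearMap.ker φ)
    (hq : 2 * Module.finrank K (A ⧸ annF φ) ≤ 2 * (n * q) + q + 1) :
    ∃ (ψ : A →ₗ[K] K) (i k : ℕ), annF φ ≤ annF ψ ∧ ψ ≠ 0 ∧ V ^ k ≤ LinearMap.ker ψ ∧ 3 ≤ k ∧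
      q = k + 2 * i ∧ n * q + 2 + i ≤ Module.finrank K (A ⧸ annF φ) ∧
      Module.finrank K ↥(V ^ 2) ≤
        Module.finrank K ↥(V ^ 2 ⊓ (annF ψ).restrictScalars K) + (2 * n + 1) := by
  induction hr : Module.finrank K (A ⧸ annF φ) using Nat.strong_induction_on generalizing φ q with
  | _ r ih =>
  have h0 := h.le_finrank hφ hV
  by_cases hc : Module.finrank K ↥(V ^ 2) ≤
        Module.finrank K ↥(V ^ 2 ⊓ (annF φ).restrictScalars K) + (2 * n + 1)
  · exact ⟨φ, 0, q, le_rfl, hφ, hV, by omega, by omega, by omega, hc⟩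
  · obtain ⟨f, hf, hfφ, hle⟩ := exists_quadric (V := V) (φ := φ) (n := n) (by omega)
    obtain ⟨q, rfl⟩ := Nat.exists_eq_add_of_le' (show 2 ≤ q by omega)
    have e : n * (q + 2) = n * q + 2 * n := by ring
    obtain ⟨ψ, i, k, h1, h2, h3, h4, h5, h6, h7⟩ := ih _ (by omega) hfφ
      (twist_pow_le_ker hf (by rwa [add_comm])) (by omega) rfl
    exact ⟨ψ, i + 1, k, (annF_le_annF_twist f φ).trans h1, h2, h3, h4, by omega, by omega, h7⟩

end IsLGP

section Castelnuovo

variable {K : Type} [Field K] {A : Type} [CommRing A] [Algebra K A] {V : Submodule K A} {n : ℕ}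

lemma IsLGP.mul_notMem_annF (h : IsLGP V n) {φ : A →ₗ[K] K} (hφ : φ ≠ 0) {k : ℕ} (hk : 2 ≤ k)
    (hV : V ^ k ≤ LinearMap.ker φ) {a b : A} (ha : a ∈ V) (ha0 : a ≠ 0) (hb : b ∈ V)
    (hb0 : b ≠ 0) : a * b ∉ annF φ := by
  obtain ⟨k, rfl⟩ := Nat.exists_eq_add_of_le hk
  have h1 := h.notMem_annF hφ (by omega) hV ha ha0
  intro hab
  refine h.notMem_annF (k := 1 + k) (fun h0 => h1 (twist_eq_zero_iff.1 h0)) (by omega) ?_ hb hb0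
    (mem_annF_twist.2 hab)
  exact twist_pow_le_ker (j := 1) (by simpa using ha) (by rwa [← add_assoc])

/-- A sequence `v 0, …, v n` in `V` on which multiplication by `a / b` acts as a shift is
linearly independent, provided no nonzero element of the pencil `⟨a, b⟩` kills an element of `V`. -/
lemma linearIndependent_of_shift [IsAlgClosed K] {N : Ideal A} {a b : A} {v : ℕ → A}
    (hv : ∀ i, v i ∈ V) (hv0 : v 0 ≠ 0)
    (hab : ∀ c : K, ∀ x ∈ V, (a - c • b) * x ∈ N → x = 0)
    (hshift : ∀ i < n, a * v i - b * v (i + 1) ∈ N) :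
    LinearIndependent K (fun i : Fin (n + 1) => v i) := by
  let E : Polynomial K → A := fun P => ∑ i ∈ Finset.range (n + 1), P.coeff i • v i
  have key : ∀ m ≤ n, ∀ P : Polynomial K, P.natDegree ≤ m → E P = 0 → P = 0 := by
    intro m
    induction m with
    | zero =>
      intro _ P hP hE
      rw [Polynomial.eq_C_of_natDegree_le_zero hP] at hE ⊢
      have : E (Polynomial.C (P.coeff 0)) = P.coeff 0 • v 0 := by
        simp only [E]
        rw [Finset.sum_eq_single 0]
        · simp
        · intro i _ hi
          simp [Polynomial.coeff_C, hi]
        · simp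
      rw [this, smul_eq_zero] at hE
      rw [hE.resolve_right hv0, Polynomial.C_0]
    | succ m ih =>
      intro hm P hP hE
      by_cases hd : P.natDegree ≤ m
      · exact ih (by omega) P hd hE
      obtain ⟨c, hc⟩ := IsAlgClosed.exists_root P (by
        intro h0
        have : P.natDegree = 0 := Polynomial.natDegree_eq_of_degree_eq_some h0
        omega)
      obtain ⟨Q, rfl⟩ := Polynomial.dvd_iff_isRoot.2 hc
      have hQ : Q.natDegree ≤ m := by
        rw [Polynomial.natDegree_mul', Polynomial.natDegree_X_sub_C] at hP
        · omega
        · rw [Polynomial.leadingCoeff_X_sub_C, one_mul]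
          intro h0
          rw [Polynomial.leadingCoeff_eq_zero.1 h0] at hd
          simp at hd
      have e1 : E ((Polynomial.X - Polynomial.C c) * Q) = E (Polynomial.X * Q) - c • E Q := by
        simp only [E, Finset.smul_sum, ← Finset.sum_sub_distrib]
        refine Finset.sum_congr rfl fun i _ => ?_
        rw [sub_mul, Polynomial.coeff_sub, Polynomial.coeff_C_mul, sub_smul, mul_smul]
      have e2 : E (Polynomial.X * Q) = ∑ i ∈ Finset.range n, Q.coeff i • v (i + 1) := by
        simp only [E]
        rw [Finset.sum_range_succ']
        simp
      have e3 : E Q = ∑ i ∈ Finset.range n, Q.coeff i • v i := by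
        simp only [E]
        rw [Finset.sum_range_succ, Polynomial.coeff_eq_zero_of_natDegree_lt (by omega), zero_smul,
          add_zero]
      have e4 : a * E Q - b * E (Polynomial.X * Q) ∈ N := by
        rw [e2, e3, Finset.mul_sum, Finset.mul_sum, ← Finset.sum_sub_distrib]
        refine Ideal.sum_mem _ fun i hi => ?_
        rw [mul_smul_comm, mul_smul_comm, ← smul_sub]
        exact (N.restrictScalars K).smul_mem _ (hshift i (Finset.mem_range.1 hi))
      rw [e1, sub_eq_zero] at hE
      have e5 : E Q = 0 := by
        refine hab c _ (Submodule.sum_mem _ fun i _ => V.smul_mem _ (hv i)) ?_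
        rw [hE, mul_smul_comm, ← smul_mul_assoc, ← sub_mul] at e4
        exact e4
      rw [ih (by omega) Q hQ e5, mul_zero]
  rw [Fintype.linearIndependent_iff]
  intro g hg
  let P : Polynomial K := ∑ i : Fin (n + 1), Polynomial.monomial (i : ℕ) (g i)
  have hc : ∀ i : Fin (n + 1), P.coeff i = g i := by
    intro i
    simp only [P, Polynomial.finsetSum_coeff, Polynomial.coeff_monomial]
    rw [Finset.sum_eq_single i]
    · simp
    · intro j _ hj
      rw [if_neg (fun h => hj (Fin.ext h))]
    · simp
  have hP : P = 0 := by
    refine key n le_rfl P ?_ ?_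
    · refine Polynomial.natDegree_sum_le_of_forall_le _ _ fun i _ => ?_
      exact (Polynomial.natDegree_monomial_le _).trans (by omega)
    · simp only [E]
      rw [Finset.sum_range, ← hg]
      exact Finset.sum_congr rfl fun i _ => by rw [hc]
  intro i
  rw [← hc i, hP, Polynomial.coeff_zero]

variable [FiniteDimensional K A]

/-- Castelnuovo's lemma. -/
lemma IsLGP.exists_normal_basis [IsAlgClosed K] (h : IsLGP V n) (hn : 1 ≤ n) {φ : A →ₗ[K] K}
    (hφ : φ ≠ 0) {k : ℕ} (hk : 3 ≤ k) (hV : V ^ k ≤ LinearMap.ker φ)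
    (hdim : Module.finrank K ↥(V ^ 2) ≤
      Module.finrank K ↥(V ^ 2 ⊓ (annF φ).restrictScalars K) + (2 * n + 1)) :
    ∃ v : ℕ → A, (∀ i, v i ∈ V) ∧ LinearIndependent K (fun i : Fin (n + 1) => v i) ∧
      ∀ i < n, ∀ j < n, v (i + 1) * v j - v i * v (j + 1) ∈ annF φ := by
  set N := annF φ with hN
  have hr : n * 3 + 2 ≤ Module.finrank K (A ⧸ N) :=
    h.le_finrank hφ ((h.pow_mono hk).trans hV)
  obtain ⟨B, hNB, hB⟩ := exists_ideal_finrank_quotient_eq (K := K) N (c := n - 1) (by omega)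
  have h1 := finrank_le_finrank_inf_add V B
  rw [h.finrank_eq, hB] at h1
  obtain ⟨a, b, hab⟩ : ∃ a b : ↥(V ⊓ B.restrictScalars K), LinearIndependent K ![a, b] := by
    have : 1 < Module.finrank K ↥(V ⊓ B.restrictScalars K) := by omega
    have : Nontrivial ↥(V ⊓ B.restrictScalars K) :=
      Module.nontrivial_of_finrank_pos (R := K) (by omega)
    obtain ⟨a, ha⟩ := exists_ne (0 : ↥(V ⊓ B.restrictScalars K))
    obtain ⟨b, hb⟩ := exists_linearIndependent_pair_of_one_lt_finrank (R := K) (by omega) ha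
    exact ⟨a, b, hb⟩
  have hab' := LinearIndependent.pair_iff.1 hab
  obtain ⟨a, haV, haB⟩ := a
  obtain ⟨b, hbV, hbB⟩ := b
  have hpencil : ∀ c : K, a - c • b ≠ 0 := by
    intro c hc
    have := hab' 1 (-c) (Subtype.ext (by simpa [sub_eq_add_neg] using hc))
    exact one_ne_zero this.1
  have hb0 : b ≠ 0 := by
    intro hb
    have := hab' 0 1 (Subtype.ext (by simpa using hb))
    exact one_ne_zero this.2
  have htop : V ^ 2 ⊔ B.restrictScalars K = ⊤ := by
    rw [← top_le_iff]
    rcases h.bot_or_top B with h' | h'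
    · rw [h', finrank_bot] at h1
      omega
    · rw [← h']
      exact sup_le_sup_right (h.le_pow (by omega)) _
  set T := (V ^ 2 ⊓ B.restrictScalars K).map (N.restrictScalars K).mkQ
  have hT : Module.finrank K T ≤ n + 2 := by
    have h2 : Module.finrank K T + _ = _ :=
      finrank_map_mkQ_add (N.restrictScalars K) (V ^ 2 ⊓ B.restrictScalars K)
    rw [inf_assoc, inf_eq_right.2 (show N.restrictScalars K ≤ B.restrictScalars K from hNB)] at h2
    have h3 := Submodule.finrank_sup_add_finrank_inf_eq (V ^ 2) (B.restrictScalars K)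
    rw [htop, finrank_top] at h3
    have h4 := finrank_quotient_add_finrank_ideal (K := K) B
    omega
  let g₀ : V × V →ₗ[K] A := LinearMap.mulLeft K a ∘ₗ V.subtype ∘ₗ LinearMap.fst K V V -
    LinearMap.mulLeft K b ∘ₗ V.subtype ∘ₗ LinearMap.snd K V V
  have hg₀ : ∀ x, g₀ x = a * x.1 - b * x.2 := fun x => rfl
  let g : V × V →ₗ[K] T := ((N.restrictScalars K).mkQ ∘ₗ g₀).codRestrict T (by
    intro x
    refine Submodule.mem_map_of_mem ⟨?_, ?_⟩
    · rw [hg₀, pow_two]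
      exact Submodule.sub_mem _ (Submodule.mul_mem_mul haV x.1.2)
        (Submodule.mul_mem_mul hbV x.2.2)
    · rw [hg₀]
      exact B.sub_mem (B.mul_mem_right _ haB) (B.mul_mem_right _ hbB))
  let Φ : (Fin (n + 1) → V) →ₗ[K] (Fin n → T) := LinearMap.pi fun i =>
    g ∘ₗ LinearMap.prod (LinearMap.proj i.castSucc) (LinearMap.proj i.succ)
  have hker : LinearMap.ker Φ ≠ ⊥ := by
    apply LinearMap.ker_ne_bot_of_finrank_lt
    rw [Module.finrank_pi_fintype, Module.finrank_pi_fintype]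
    simp only [Finset.sum_const, Finset.card_univ, Fintype.card_fin, smul_eq_mul, h.finrank_eq]
    nlinarith
  obtain ⟨u, hu, hu0⟩ := Submodule.exists_mem_ne_zero_of_ne_bot hker
  let v : ℕ → A := fun i => if hi : i < n + 1 then (u ⟨i, hi⟩ : A) else 0
  have hvV : ∀ i, v i ∈ V := by
    intro i
    by_cases hi : i < n + 1
    · simp only [v, hi, dif_pos]
      exact (u _).2
    · simp only [v, hi, dif_neg, not_false_eq_true]
      exact V.zero_mem
  have hshift : ∀ i < n, a * v i - b * v (i + 1) ∈ N := by
    intro i hi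
    have h2 : g (u (Fin.castSucc ⟨i, hi⟩), u (Fin.succ ⟨i, hi⟩)) = 0 := congrFun hu ⟨i, hi⟩
    have h3 := (Submodule.Quotient.mk_eq_zero (N.restrictScalars K)).1 (congrArg Subtype.val h2)
    rw [hg₀] at h3
    simp only [v, dif_pos (show i < n + 1 by omega), dif_pos (show i + 1 < n + 1 by omega)]
    exact h3
  have hprod : ∀ x ∈ V, ∀ y ∈ V, x ≠ 0 → x * y ∈ N → y = 0 := by
    intro x hx y hy hx0 hxy
    by_contra hy0
    exact h.mul_notMem_annF hφ (by omega) hV hx hx0 hy hy0 hxy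
  have hv0 : v 0 ≠ 0 := by
    intro h0
    have hall : ∀ i ≤ n, v i = 0 := by
      intro i
      induction i with
      | zero => exact fun _ => h0
      | succ i ih =>
        intro hi
        have h2 := hshift i (by omega)
        rw [ih (by omega), mul_zero, zero_sub] at h2
        exact hprod b hbV _ (hvV _) hb0 (by simpa using N.neg_mem h2)
    refine hu0 (funext fun i => Subtype.ext ?_)
    have := hall i (by omega)
    simp only [v, dif_pos i.2] at this
    exact this
  refine ⟨v, hvV, linearIndependent_of_shift hvV hv0 (N := N) (a := a) (b := b) ?_ hshift, ?_⟩
  · intro c x hx hcx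
    exact hprod _ (V.sub_mem haV (V.smul_mem _ hbV)) x hx (hpencil c) hcx
  · intro i hi j hj
    by_contra hm
    obtain ⟨k, rfl⟩ := Nat.exists_eq_add_of_le (show 2 ≤ k by omega)
    refine h.notMem_annF (k := k) (fun h0 => hm (twist_eq_zero_iff.1 h0)) (by omega)
      (twist_pow_le_ker ?_ hV) hbV hb0 (mem_annF_twist.2 ?_)
    · rw [pow_two]
      exact Submodule.sub_mem _ (Submodule.mul_mem_mul (hvV _) (hvV _))
        (Submodule.mul_mem_mul (hvV _) (hvV _))
    · have e : (v (i + 1) * v j - v i * v (j + 1)) * b =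
          v i * (a * v j - b * v (j + 1)) - v j * (a * v i - b * v (i + 1)) := by ring
      rw [e]
      exact N.sub_mem (N.mul_mem_left _ (hshift j hj)) (N.mul_mem_left _ (hshift i hi))

/-- A scheme in linearly general position with a short dependency in degree `q` has the support of
this dependency on a rational normal curve. -/
lemma IsLGP.exists_normal_basis_of_le [IsAlgClosed K] (h : IsLGP V n) (hn : 1 ≤ n) {q : ℕ}
    {φ : A →ₗ[K] K} (hφ : φ ≠ 0) (hV : V ^ q ≤ LinearMap.ker φ)
    (hq : Module.finrank K (A ⧸ annF φ) * (2 * n + 2) + n * (2 * n + 3) ≤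
      q * (n * (2 * n + 3)) + (2 * n + 2)) :
    ∃ v : ℕ → A, (∀ i, v i ∈ V) ∧ LinearIndependent K (fun i : Fin (n + 1) => v i) ∧
      ∀ i < n, ∀ j < n, v (i + 1) * v j - v i * v (j + 1) ∈ annF φ := by
  obtain ⟨e, he⟩ := Nat.exists_eq_add_of_le (h.le_finrank hφ hV)
  have he' : (2 * n + 2) * e + 2 * n * n + 5 * n + 2 ≤ n * q := by
    rw [he] at hq
    nlinarith
  have hq' : 2 * e + 3 ≤ q := by
    by_contra! hlt
    nlinarith
  obtain ⟨ψ, i, k, h1, h2, h3, h4, h5, h6, h7⟩ := h.exists_residual hφ hV (by omega)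
  obtain ⟨v, hv, hvi, hvm⟩ := h.exists_normal_basis hn h2 h4 h3 h7
  refine ⟨v, hv, hvi, fun i' hi' j' hj' => ?_⟩
  by_contra hm
  set f := v (i' + 1) * v j' - v i' * v (j' + 1) with hf
  have hfV : f ∈ V ^ 2 := by
    rw [pow_two]
    exact Submodule.sub_mem _ (Submodule.mul_mem_mul (hv _) (hv _))
      (Submodule.mul_mem_mul (hv _) (hv _))
  have hfψ : f ∈ annF ψ := hvm i' hi' j' hj'
  have h8 := finrank_residual φ f
  have h9 := finrank_quotient_le_of_le (K := K) (N := annF φ ⊔ Ideal.span {f}) (B := annF ψ)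
    (sup_le h1 ((Ideal.span_singleton_le_iff_mem _).2 hfψ))
  have h10 := h.le_finrank h2 h3
  obtain ⟨q, rfl⟩ := Nat.exists_eq_add_of_le' (show 2 ≤ q by omega)
  have h11 := h.le_finrank (k := q) (φ := twist f φ) (fun h0 => hm (twist_eq_zero_iff.1 h0))
    (twist_pow_le_ker hfV (by rwa [add_comm]))
  have hie : i ≤ e := by omega
  have h12 : n * i ≤ n * e := Nat.mul_le_mul_left n hie
  have h13 : n * (q + 2) = n * k + 2 * (n * i) := by rw [h5]; ring
  nlinarith

end Castelnuovo

section RationalNormalCurve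

variable {K : Type} [Field K] {A : Type} [CommRing A] [Algebra K A] {n : ℕ}

lemma span_binary_monomials (n : ℕ) :
    Submodule.span K (Set.range fun i : Fin (n + 1) =>
      (X 0 ^ (n - i : ℕ) * X 1 ^ (i : ℕ) : MvPolynomial (Fin 2) K)) =
      homogeneousSubmodule (Fin 2) K n := by
  apply le_antisymm
  · rw [Submodule.span_le]
    rintro _ ⟨i, rfl⟩
    have := ((isHomogeneous_X K (0 : Fin 2)).pow (n - i : ℕ)).mul
      ((isHomogeneous_X K (1 : Fin 2)).pow (i : ℕ))
    rwa [show 1 * (n - i : ℕ) + 1 * (i : ℕ) = n by omega] at this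
  · intro F hF
    rw [F.as_sum]
    refine Submodule.sum_mem _ fun s hs => ?_
    have hs' : s 0 + s 1 = n := by
      have : s.degree = n :=
        (DFunLike.congr_fun Finsupp.degree_eq_weight_one s).trans (hF (mem_support_iff.1 hs))
      rwa [Finsupp.degree_eq_sum, Fin.sum_univ_two] at this
    have h : monomial s (coeff s F) =
        coeff s F • (X 0 ^ (n - s 1) * X 1 ^ (s 1) : MvPolynomial (Fin 2) K) := by
      rw [monomial_eq, Finsupp.prod_fintype _ _ (by simp), Fin.prod_univ_two, smul_eq_C_mul,
        ← hs', Nat.add_sub_cancel]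
    rw [h]
    exact Submodule.smul_mem _ _ (Submodule.subset_span ⟨⟨s 1, by omega⟩, rfl⟩)

lemma aeval_mul_of_isHomogeneous {F : MvPolynomial (Fin (n + 1)) K} {e : ℕ}
    (hF : F.IsHomogeneous e) (b : A) (z : Fin (n + 1) → A) :
    aeval (fun j => b * z j) F = b ^ e * aeval z F := by
  simp only [aeval_def, eval₂_eq, Finset.mul_sum]
  refine Finset.sum_congr rfl fun d hd => ?_
  have hd' : ∑ i ∈ d.support, d i = e :=
    (DFunLike.congr_fun Finsupp.degree_eq_weight_one d).trans (hF (mem_support_iff.1 hd))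
  simp only [mul_pow, Finset.prod_mul_distrib, Finset.prod_pow_eq_pow_sum, hd']
  ring

lemma mem_iInf_ker_eval_iff [Infinite K] {p : Fin (n + 1) → MvPolynomial (Fin 2) K}
    {F : MvPolynomial (Fin (n + 1)) K} :
    F ∈ (⨅ x : Fin 2 → K, RingHom.ker (eval (fun i => eval x (p i)) :
      MvPolynomial (Fin (n + 1)) K →+* K)) ↔ aeval p F = 0 := by
  have h (x : Fin 2 → K) : eval (fun i => eval x (p i)) F = eval x (aeval p F) := by
    simpa [aeval_eq_eval] using (DFunLike.congr_fun (comp_aeval (R := K) p (aeval x)) F).symm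
  simp only [Submodule.mem_iInf, RingHom.mem_ker, h]
  exact ⟨fun h0 => funext fun x => by rw [h0, map_zero], fun h0 x => by rw [h0, map_zero]⟩

lemma aeval_homogeneousComponent_eq_zero {t : ℕ} (ht : 1 ≤ t)
    {p : Fin (n + 1) → MvPolynomial (Fin 2) K} (hp : ∀ i, (p i).IsHomogeneous t)
    {F : MvPolynomial (Fin (n + 1)) K} (hF : aeval p F = 0) (e : ℕ) :
    aeval p (homogeneousComponent e F) = 0 := by
  have h1 (i : ℕ) : (aeval p (homogeneousComponent i F)).IsHomogeneous (t * i) :=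
    (homogeneousComponent_isHomogeneous i F).aeval _ hp
  by_cases he : e ∈ Finset.range (F.totalDegree + 1)
  · have h2 := congrArg (homogeneousComponent (t * e)) hF
    rw [← sum_homogeneousComponent F, map_sum, map_sum, Finset.sum_eq_single_of_mem e he,
      homogeneousComponent_of_mem (h1 e), if_pos rfl, map_zero] at h2
    · exact h2
    · intro i _ hi
      rw [homogeneousComponent_of_mem (h1 i), if_neg]
      exact fun h => hi (Nat.eq_of_mul_eq_mul_left (by omega) h).symm
  · rw [homogeneousComponent_eq_zero _ _ (by simpa [Nat.lt_succ_iff] using he), map_zero]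

lemma IsRNC.isHomogeneous [Infinite K] {t : ℕ} (ht : 1 ≤ t)
    {J : Ideal (MvPolynomial (Fin (n + 1)) K)} (hJ : IsRNC t J) :
    J.IsHomogeneous (homogeneousSubmodule (Fin (n + 1)) K) := by
  obtain ⟨p, hp, -, rfl⟩ := hJ
  intro e F hF
  rw [mem_iInf_ker_eval_iff] at hF ⊢
  exact (congrArg (aeval p) (decomposition.decompose'_apply F e)).trans
    (aeval_homogeneousComponent_eq_zero ht hp hF e)

/-- In a ring where the `2 × 2` minors of a `2 × n` Hankel matrix vanish, its entries are, up to a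
factor, the monomials in the first two entries. -/
lemma hankel_pow_mul {R : Type} [CommRing R] {w : ℕ → R}
    (hw : ∀ i < n, ∀ j < n, w (i + 1) * w j = w i * w (j + 1)) {i : ℕ} (hi : i ≤ n) :
    w 0 ^ n * w i = w 0 * (w 0 ^ (n - i) * w 1 ^ i) := by
  have key : ∀ i ≤ n, w 0 ^ i * w i = w 0 * w 1 ^ i := by
    intro i
    induction i with
    | zero => intro _; ring
    | succ i ih =>
      intro hi
      have h1 := ih (by omega)
      have h2 := hw 0 (by omega) i (by omega)
      calc w 0 ^ (i + 1) * w (i + 1) = w 0 ^ i * (w 0 * w (i + 1)) := by ring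
        _ = w 1 * (w 0 ^ i * w i) := by rw [← h2]; ring
        _ = w 0 * w 1 ^ (i + 1) := by rw [h1]; ring
  calc w 0 ^ n * w i = w 0 ^ (n - i) * (w 0 ^ i * w i) := by
        rw [← mul_assoc, ← pow_add, Nat.sub_add_cancel hi]
    _ = _ := by rw [key i hi]; ring

lemma hankel_mem_radical {R : Type} [CommRing R] {w : ℕ → R}
    (hw : ∀ i < n, ∀ j < n, w (i + 1) * w j = w i * w (j + 1)) {B : Ideal R}
    (h0 : w 0 ∈ B.radical) (hn : w n ∈ B.radical) {i : ℕ} (hi : i ≤ n) : w i ∈ B.radical := by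
  induction i with
  | zero => exact h0
  | succ i ih =>
    rcases hi.eq_or_lt with rfl | hlt
    · exact hn
    · refine Ideal.mem_radical_of_pow_mem (m := 2) ?_
      rw [pow_two, hw i (by omega) (i + 1) (by omega)]
      exact Ideal.mul_mem_right _ _ (ih (by omega))

/-- If `c w_i = c' σ^(n-i) τ^i` for all `i`, then `c` is nilpotent on the values of
the forms vanishing on the rational normal curve. -/
lemma pow_mul_eq_zero_of_aeval_eq_zero {R : Type} [CommRing R] [Algebra K R]
    {p : Fin (n + 1) → MvPolynomial (Fin 2) K} {y : Fin (n + 1) → R} {c c' : R} {s : Fin 2 → R}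
    (hy : ∀ j, c * y j = c' * aeval s (p j)) {e : ℕ} {F : MvPolynomial (Fin (n + 1)) K}
    (hF : F.IsHomogeneous e) (hpF : aeval p F = 0) : c ^ e * aeval y F = 0 := by
  have h1 : aeval s (aeval p F) = aeval (fun j => aeval s (p j)) F :=
    DFunLike.congr_fun (comp_aeval (R := K) p (aeval s)) F
  rw [← aeval_mul_of_isHomogeneous hF, _root_.funext hy, aeval_mul_of_isHomogeneous hF, ← h1,
    hpF, map_zero, mul_zero]

/-- A scheme on which the `2 × 2` minors of a Hankel matrix of linear forms vanish lies on a
rational normal curve. -/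
lemma exists_isRNC_map_le [Infinite K] (hn : 1 ≤ n) (θ : MvPolynomial (Fin (n + 1)) K →ₐ[K] A)
    {N : Ideal A} {v : ℕ → A} (hvi : LinearIndependent K (fun i : Fin (n + 1) => v i))
    (hv : Submodule.span K (Set.range fun i : Fin (n + 1) => v i) =
      (homogeneousSubmodule (Fin (n + 1)) K 1).map θ.toLinearMap)
    (h1 : 1 ∈ (homogeneousSubmodule (Fin (n + 1)) K 1).map θ.toLinearMap)
    (hm : ∀ i < n, ∀ j < n, v (i + 1) * v j - v i * v (j + 1) ∈ N) :
    ∃ J : Ideal (MvPolynomial (Fin (n + 1)) K), IsRNC n J ∧ J.map θ ≤ N := by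
  let μ : Fin (n + 1) → MvPolynomial (Fin 2) K := fun i => X 0 ^ (n - i : ℕ) * X 1 ^ (i : ℕ)
  obtain ⟨L, hL⟩ := ((Module.Basis.span hvi).constr K μ).exists_extend
  have hLv (i : Fin (n + 1)) : L (v i) = μ i := by
    have h := DFunLike.congr_fun hL (Module.Basis.span hvi i)
    rw [Module.Basis.constr_basis, LinearMap.comp_apply, Submodule.subtype_apply,
      Module.Basis.span_apply] at h
    exact h
  have hθX (j : Fin (n + 1)) : θ (X j) ∈ Submodule.span K (Set.range fun i : Fin (n + 1) => v i) :=
    hv ▸ ⟨X j, isHomogeneous_X K j, rfl⟩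
  have hspan : Submodule.span K (Set.range fun j => L (θ (X j))) =
      homogeneousSubmodule (Fin 2) K n := by
    rw [← span_binary_monomials, show (fun j => L (θ (X j))) = (L ∘ₗ θ.toLinearMap) ∘ X from rfl,
      Set.range_comp, ← Submodule.map_span, ← homogeneousSubmodule_one_eq_span_X,
      Submodule.map_comp, ← hv, Submodule.map_span, ← Set.range_comp]
    exact congrArg _ (congrArg _ (_root_.funext hLv))
  set p : Fin (n + 1) → MvPolynomial (Fin 2) K := fun j => L (θ (X j)) with hp_def
  have hp (j : Fin (n + 1)) : (p j).IsHomogeneous n := by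
    have : p j ∈ homogeneousSubmodule (Fin 2) K n := hspan ▸ Submodule.subset_span ⟨j, rfl⟩
    exact this
  refine ⟨_, ⟨p, hp, hspan, rfl⟩, Ideal.map_le_iff_le_comap.2 fun F hF => ?_⟩
  rw [mem_iInf_ker_eval_iff] at hF
  rw [← sum_homogeneousComponent F]
  refine Ideal.sum_mem _ fun e _ => ?_
  have hG := aeval_homogeneousComponent_eq_zero hn hp hF e
  have hGe := homogeneousComponent_isHomogeneous e F
  generalize homogeneousComponent e F = G at hG hGe
  let π : A →ₐ[K] A ⧸ N := Ideal.Quotient.mkₐ K N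
  have hw : ∀ i < n, ∀ j < n, π (v (i + 1)) * π (v j) = π (v i) * π (v (j + 1)) := by
    intro i hi j hj
    rw [← map_mul, ← map_mul]
    exact Ideal.Quotient.eq.2 (hm i hi j hj)
  have hπG : π (θ G) = aeval (fun j => π (θ (X j))) G :=
    DFunLike.congr_fun (aeval_unique (π.comp θ)) G
  have main (c c' : A ⧸ N) (s : Fin 2 → A ⧸ N)
      (hc : ∀ i ≤ n, c * π (v i) = c' * (s 0 ^ (n - i) * s 1 ^ i)) : c ^ e * π (θ G) = 0 := by
    rw [hπG]
    refine pow_mul_eq_zero_of_aeval_eq_zero (c' := c') (s := s) (fun j => ?_) hGe hG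
    refine Submodule.span_induction (p := fun x _ => c * π x = c' * aeval s (L x)) ?_ (by simp)
      (fun x y _ _ hx hy => by simp only [map_add, mul_add, hx, hy])
      (fun a x _ hx => by simp only [map_smul, mul_smul_comm, hx]) (hθX j)
    rintro _ ⟨i, rfl⟩
    simp only [hLv, μ, map_mul, map_pow, aeval_X, hc i (by omega)]
  let B : Ideal (A ⧸ N) := (⊥ : Ideal (A ⧸ N)).colon {π (θ G)}
  have hB (x : A ⧸ N) : x ∈ B ↔ x * π (θ G) = 0 := by
    simp [B, Submodule.mem_colon]
  have hrad (x : A ⧸ N) (h : (x ^ n) ^ e * π (θ G) = 0) : x ∈ B.radical :=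
    ⟨n * e, by rwa [hB, pow_mul]⟩
  have hr0 : π (v 0) ∈ B.radical := hrad _ <| main _ (π (v 0)) ![π (v 0), π (v 1)] fun i hi =>
    hankel_pow_mul (w := fun i => π (v i)) hw hi
  have hrn : π (v n) ∈ B.radical := hrad _ <| main _ (π (v n)) ![π (v (n - 1)), π (v n)]
    fun i hi => by
      have := hankel_pow_mul (n := n) (w := fun i => π (v (n - i))) (fun i hi j hj => by
        have := hw (n - (i + 1)) (by omega) (n - (j + 1)) (by omega)
        rw [show n - (i + 1) + 1 = n - i by omega, show n - (j + 1) + 1 = n - j by omega] at this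
        exact this.symm) (Nat.sub_le n i)
      simp only [Nat.sub_sub_self hi, Nat.sub_zero] at this
      rw [this, mul_comm (π (v n) ^ i)]
      rfl
  have hle : Submodule.span K (Set.range fun i : Fin (n + 1) => v i) ≤
      (B.radical.comap π).restrictScalars K := by
    rw [Submodule.span_le]
    rintro _ ⟨i, rfl⟩
    exact hankel_mem_radical (w := fun i => π (v i)) hw hr0 hrn (by omega)
  have h1B : (1 : A ⧸ N) ∈ B.radical := map_one π ▸ hle (hv ▸ h1)
  obtain ⟨k, hk⟩ := h1B
  rw [one_pow, hB, one_mul] at hk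
  exact (Ideal.Quotient.eq_zero_iff_mem (I := N)).1 hk

end RationalNormalCurve

section Dehomogenization

variable {K : Type} [Field K] {A : Type} [CommRing A] [Algebra K A] {n : ℕ}
  {I J : Ideal (MvPolynomial (Fin (n + 1)) K)} {θ : MvPolynomial (Fin (n + 1)) K →ₐ[K] A}
  {ℓ : MvPolynomial (Fin (n + 1)) K}

lemma mem_saturate_iff {F : MvPolynomial (Fin (n + 1)) K} :
    F ∈ saturate I ↔ ∃ k, ∀ G ∈ irrelevantIdeal K n ^ k, F * G ∈ I := by
  unfold saturate
  rw [Submodule.mem_iSup_of_directed]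
  · simp only [Submodule.mem_colon, smul_eq_mul, SetLike.mem_coe]
  · refine Monotone.directed_le fun i j hij F hF => ?_
    rw [Submodule.mem_colon] at hF ⊢
    exact fun G hG => hF G (Ideal.pow_le_pow_right hij hG)

lemma mem_irrelevantIdeal_pow {G : MvPolynomial (Fin (n + 1)) K} {j : ℕ} (hG : G.IsHomogeneous j) :
    G ∈ irrelevantIdeal K n ^ j := by
  refine (mem_pow_idealOfVars_iff j G).2 fun x hx => ?_
  exact ((DFunLike.congr_fun Finsupp.degree_eq_weight_one x).trans
    (hG (mem_support_iff.1 hx))).ge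

lemma mem_saturate_of_isHomogeneous {F : MvPolynomial (Fin (n + 1)) K} {k : ℕ}
    (h : ∀ j, k ≤ j → ∀ G : MvPolynomial (Fin (n + 1)) K, G.IsHomogeneous j → F * G ∈ I) :
    F ∈ saturate I := by
  refine mem_saturate_iff.2 ⟨k, fun G hG => ?_⟩
  rw [← sum_homogeneousComponent G, Finset.mul_sum]
  refine Ideal.sum_mem _ fun j _ => ?_
  by_cases hj : k ≤ j
  · exact h j hj _ (homogeneousComponent_isHomogeneous j G)
  · have : homogeneousComponent j G = 0 := by
      rw [homogeneousComponent_apply]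
      refine Finset.sum_eq_zero fun d hd => ?_
      rw [Finset.mem_filter] at hd
      exact absurd (hd.2 ▸ (mem_pow_idealOfVars_iff k G).1 hG d hd.1) hj
    rw [this, mul_zero]
    exact I.zero_mem

/-- A saturated ideal has a linear nonzerodivisor. -/
lemma exists_linear_nonzerodivisor [Infinite K] (hI : saturate I = I) :
    ∃ ℓ : MvPolynomial (Fin (n + 1)) K, ℓ.IsHomogeneous 1 ∧
      Ideal.Quotient.mk I ℓ ∈ nonZeroDivisors (MvPolynomial (Fin (n + 1)) K ⧸ I) := by
  by_contra! hcon
  let R := MvPolynomial (Fin (n + 1)) K ⧸ I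
  have : Finite (associatedPrimes R R) := associatedPrimes.finite R R
  let W (P : associatedPrimes R R) : Subspace K (homogeneousSubmodule (Fin (n + 1)) K 1) :=
    ((P.1.comap (Ideal.Quotient.mkₐ K I)).restrictScalars K).comap (Submodule.subtype _)
  obtain ⟨⟨P, hP⟩, hW⟩ := Subspace.exists_eq_top_of_iUnion_eq_univ (p := W) <| by
    refine Set.eq_univ_of_forall fun x => ?_
    have hx : Ideal.Quotient.mk I x.1 ∈ ⋃ p ∈ associatedPrimes R R, (p : Set R) := by
      rw [biUnion_associatedPrimes_eq_compl_nonZeroDivisors]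
      exact hcon x.1 x.2
    obtain ⟨P, hP, hxP⟩ := Set.mem_iUnion₂.1 hx
    exact Set.mem_iUnion.2 ⟨⟨P, hP⟩, hxP⟩
  rw [AssociatedPrimes.mem_iff, isAssociatedPrime_iff] at hP
  obtain ⟨hprime, x, rfl⟩ := hP
  obtain ⟨F, rfl⟩ := Ideal.Quotient.mk_surjective x
  have hF : F ∈ I := by
    rw [← hI]
    refine mem_saturate_iff.2 ⟨1, fun G hG => ?_⟩
    rw [pow_one] at hG
    have hle : irrelevantIdeal K n ≤ I.colon {F} := by
      refine Ideal.span_le.2 ?_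
      rintro _ ⟨i, rfl⟩
      have h : (⟨X i, isHomogeneous_X K i⟩ : homogeneousSubmodule (Fin (n + 1)) K 1) ∈
        W ⟨_, AssociatedPrimes.mem_iff.2 (isAssociatedPrime_iff.2 ⟨hprime, _, rfl⟩)⟩ :=
          hW ▸ Submodule.mem_top
      have h2 : Ideal.Quotient.mk I (X i) * Ideal.Quotient.mk I F = 0 := by
        simpa [W, Submodule.mem_colon] using h
      rw [SetLike.mem_coe, Submodule.mem_colon_singleton, smul_eq_mul]
      rwa [← map_mul, Ideal.Quotient.eq_zero_iff_mem] at h2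
    have := hle hG
    rwa [Submodule.mem_colon_singleton, smul_eq_mul, mul_comm] at this
  refine hprime.ne_top ((Ideal.eq_top_iff_one _).2 ?_)
  rw [Submodule.mem_colon_singleton, Ideal.Quotient.eq_zero_iff_mem.2 hF, smul_zero]
  exact Submodule.zero_mem _

/-- `θ` identifies `A` with the coordinate ring of the part of the scheme with ideal `I` off
the hyperplane `ℓ = 0`, which misses the scheme. -/
structure IsDehomogenization (I : Ideal (MvPolynomial (Fin (n + 1)) K))
    (θ : MvPolynomial (Fin (n + 1)) K →ₐ[K] A) (ℓ : MvPolynomial (Fin (n + 1)) K) : Prop where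
  surjective : Function.Surjective θ
  isHomogeneous : ℓ.IsHomogeneous 1
  map_eq_one : θ ℓ = 1
  eq_zero_of_mem : ∀ F ∈ I, θ F = 0
  mem_of_eq_zero : ∀ {m : ℕ} {F : MvPolynomial (Fin (n + 1)) K}, F.IsHomogeneous m → θ F = 0 → F ∈ I

lemma exists_isDehomogenization [Infinite K]
    (hI : I.IsHomogeneous (homogeneousSubmodule (Fin (n + 1)) K)) (hsat : saturate I = I) :
    ∃ (A : Type) (_ : CommRing A) (_ : Algebra K A) (θ : MvPolynomial (Fin (n + 1)) K →ₐ[K] A)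
      (ℓ : MvPolynomial (Fin (n + 1)) K), IsDehomogenization I θ ℓ := by
  obtain ⟨ℓ, hℓ, hℓI⟩ := exists_linear_nonzerodivisor hsat
  let R := MvPolynomial (Fin (n + 1)) K ⧸ I
  let Q := FractionRing R
  let π : MvPolynomial (Fin (n + 1)) K →ₐ[K] Q :=
    (IsScalarTower.toAlgHom K R Q).comp (Ideal.Quotient.mkₐ K I)
  have hπ (F) : π F = 0 ↔ F ∈ I := by
    rw [← Ideal.Quotient.eq_zero_iff_mem, ← map_eq_zero_iff _ (IsFractionRing.injective R Q)]
    rfl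
  obtain ⟨u, hu⟩ : ∃ u, u * π ℓ = 1 :=
    (IsLocalization.map_units Q ⟨_, hℓI⟩).exists_left_inv
  let ψ : MvPolynomial (Fin (n + 1)) K →ₐ[K] Q := aeval fun i => u * π (X i)
  have hψ {e : ℕ} {F : MvPolynomial (Fin (n + 1)) K} (hF : F.IsHomogeneous e) :
      ψ F = u ^ e * π F := by
    rw [aeval_mul_of_isHomogeneous hF]
    exact congrArg _ (DFunLike.congr_fun (aeval_unique π) F).symm
  have hmem {e : ℕ} {F : MvPolynomial (Fin (n + 1)) K} (hF : F.IsHomogeneous e) :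
      ψ F = 0 ↔ F ∈ I := by
    rw [hψ hF, ← hπ]
    refine ⟨fun h => ?_, fun h => by rw [h, mul_zero]⟩
    calc π F = (u * π ℓ) ^ e * π F := by rw [hu, one_pow, one_mul]
      _ = π ℓ ^ e * (u ^ e * π F) := by ring
      _ = 0 := by rw [h, mul_zero]
  refine ⟨ψ.range, inferInstance, inferInstance, ψ.rangeRestrict, ℓ,
    ψ.rangeRestrict_surjective, hℓ, ?_, fun F hF => ?_, fun hF h0 => (hmem hF).1 ?_⟩
  · exact Subtype.ext (by simpa [hu] using hψ hℓ)
  · refine Subtype.ext ?_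
    change ψ F = 0
    rw [← sum_homogeneousComponent F, map_sum]
    refine Finset.sum_eq_zero fun e _ => (hmem (homogeneousComponent_isHomogeneous e F)).2 ?_
    have := hI e hF
    exact decomposition.decompose'_apply F e ▸ this
  · exact congrArg Subtype.val h0

end Dehomogenization

section SchemeDegree

variable {K : Type} [Field K] {A : Type} [CommRing A] [Algebra K A] {n : ℕ}
  {I J : Ideal (MvPolynomial (Fin (n + 1)) K)} {θ : MvPolynomial (Fin (n + 1)) K →ₐ[K] A}
  {ℓ : MvPolynomial (Fin (n + 1)) K}

lemma finrank_map_eq_of_ker {M P Q : Type} [AddCommGroup M] [Module K M] [AddCommGroup P]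
    [Module K P] [AddCommGroup Q] [Module K Q] {U : Submodule K M} {f : M →ₗ[K] P} {g : M →ₗ[K] Q}
    (h : ∀ x ∈ U, f x = 0 ↔ g x = 0) :
    Module.finrank K (U.map f) = Module.finrank K (U.map g) := by
  have hker : LinearMap.ker (f ∘ₗ U.subtype) = LinearMap.ker (g ∘ₗ U.subtype) := by
    ext x
    exact h x x.2
  have e := ((f ∘ₗ U.subtype).quotKerEquivRange.symm ≪≫ₗ Submodule.quotEquivOfEq _ _ hker ≪≫ₗ
    (g ∘ₗ U.subtype).quotKerEquivRange).finrank_eq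
  rwa [LinearMap.range_comp, LinearMap.range_comp, Submodule.range_subtype] at e

lemma schemeDeg_eq {d : ℕ} (h : ∀ᶠ m : ℕ in atTop, hilbF I m = d) : schemeDeg I = d := by
  have hex : ∃ d : ℕ, ∀ᶠ m : ℕ in atTop, hilbF I m = d := ⟨d, h⟩
  rw [schemeDeg, dif_pos hex]
  obtain ⟨m, h1, h2⟩ := (hex.choose_spec.and h).exists
  exact h1.symm.trans h2

/-- The image in `A` of the space of linear forms. -/
noncomputable def linearForms (θ : MvPolynomial (Fin (n + 1)) K →ₐ[K] A) : Submodule K A :=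
  (homogeneousSubmodule (Fin (n + 1)) K 1).map θ.toLinearMap

lemma map_homogeneousSubmodule (θ : MvPolynomial (Fin (n + 1)) K →ₐ[K] A) (m : ℕ) :
    (homogeneousSubmodule (Fin (n + 1)) K m).map θ.toLinearMap = linearForms θ ^ m := by
  rw [linearForms, ← homogeneousSubmodule_one_pow, Submodule.map_pow]

instance finiteDimensional_linearForms (θ : MvPolynomial (Fin (n + 1)) K →ₐ[K] A) :
    FiniteDimensional K (linearForms θ) :=
  Module.Finite.iff_fg.2 ((homogeneousSubmodule_fg _ _ 1).map _)

namespace IsDehomogenization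

lemma one_mem (h : IsDehomogenization I θ ℓ) : (1 : A) ∈ linearForms θ :=
  ⟨ℓ, h.isHomogeneous, h.map_eq_one⟩

lemma hilbF_eq (h : IsDehomogenization I θ ℓ) (m : ℕ) :
    hilbF I m = Module.finrank K ↥(linearForms θ ^ m) := by
  rw [← map_homogeneousSubmodule]
  refine finrank_map_eq_of_ker fun F hF => ?_
  change Ideal.Quotient.mk I F = 0 ↔ θ F = 0
  rw [Ideal.Quotient.eq_zero_iff_mem]
  exact ⟨h.eq_zero_of_mem F, h.mem_of_eq_zero hF⟩

lemma pow_mono (h : IsDehomogenization I θ ℓ) {i j : ℕ} (hij : i ≤ j) :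
    linearForms θ ^ i ≤ linearForms θ ^ j :=
  pow_le_pow_right' (Submodule.one_le.2 h.one_mem) hij

/-- Multiplying by powers of `ℓ`, elements of a homogeneous ideal become homogeneous. -/
lemma exists_homogeneous_of_mem_map (h : IsDehomogenization I θ ℓ)
    (hJ : J.IsHomogeneous (homogeneousSubmodule (Fin (n + 1)) K))
    {a : A} (ha : a ∈ J.map θ) : ∃ D, ∃ F ∈ J, F.IsHomogeneous D ∧ θ F = a := by
  obtain ⟨F, hF, rfl⟩ := (Ideal.mem_map_iff_of_surjective θ h.surjective).1 ha
  refine ⟨F.totalDegree, ∑ i ∈ Finset.range (F.totalDegree + 1),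
    ℓ ^ (F.totalDegree - i) * homogeneousComponent i F, ?_, ?_, ?_⟩
  · refine Ideal.sum_mem _ fun i _ => J.mul_mem_left _ ?_
    have := hJ i hF
    exact decomposition.decompose'_apply F i ▸ this
  · refine IsHomogeneous.sum _ _ _ fun i hi => ?_
    have := (h.isHomogeneous.pow (F.totalDegree - i)).mul (homogeneousComponent_isHomogeneous i F)
    rwa [one_mul, Nat.sub_add_cancel (Nat.lt_succ_iff.1 (Finset.mem_range.1 hi))] at this
  · conv_rhs => rw [← sum_homogeneousComponent F]
    simp only [map_sum, map_mul, map_pow, h.map_eq_one, one_pow, one_mul]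

lemma exists_mem_pow (h : IsDehomogenization I θ ℓ) (a : A) : ∃ D, a ∈ linearForms θ ^ D := by
  obtain ⟨D, F, -, hF, rfl⟩ := h.exists_homogeneous_of_mem_map (J := ⊤) (fun _ _ _ => trivial)
    (a := a) (by rw [Ideal.map_top]; trivial)
  exact ⟨D, map_homogeneousSubmodule θ D ▸ ⟨F, hF, rfl⟩⟩

lemma eventually_pow_eq_top (h : IsDehomogenization I θ ℓ) {d : ℕ}
    (hd : ∀ᶠ m : ℕ in atTop, hilbF I m = d) :
    ∀ᶠ m : ℕ in atTop, linearForms θ ^ m = ⊤ := by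
  obtain ⟨M, hM⟩ := eventually_atTop.1 hd
  have hfin (m : ℕ) : FiniteDimensional K ↥(linearForms θ ^ m) :=
    Module.Finite.iff_fg.2 ((Module.Finite.iff_fg.1 inferInstance).pow m)
  have heq : ∀ m ≥ M, linearForms θ ^ M = linearForms θ ^ m := fun m hm =>
    Submodule.eq_of_le_of_finrank_eq (h.pow_mono hm) <| by
      rw [← h.hilbF_eq, ← h.hilbF_eq, hM _ le_rfl, hM _ hm]
  refine eventually_atTop.2 ⟨M, fun m hm => eq_top_iff.2 fun a _ => ?_⟩
  obtain ⟨D, hD⟩ := h.exists_mem_pow a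
  rw [← heq m hm, heq (max M D) (le_max_left _ _)]
  exact h.pow_mono (le_max_right _ _) hD

lemma finiteDimensional (h : IsDehomogenization I θ ℓ) {d : ℕ}
    (hd : ∀ᶠ m : ℕ in atTop, hilbF I m = d) :
    FiniteDimensional K A := by
  obtain ⟨m, hm⟩ := (h.eventually_pow_eq_top hd).exists
  exact ⟨hm ▸ (Module.Finite.iff_fg.1 inferInstance : (linearForms θ).FG).pow m⟩

lemma finrank_eq (h : IsDehomogenization I θ ℓ) {d : ℕ}
    (hd : ∀ᶠ m : ℕ in atTop, hilbF I m = d) : Module.finrank K A = d := by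
  obtain ⟨m, h1, h2⟩ := ((h.eventually_pow_eq_top hd).and hd).exists
  rw [← h2, h.hilbF_eq, h1, finrank_top]

lemma exists_mem_sup_of_map_mem [FiniteDimensional K A] (h : IsDehomogenization I θ ℓ)
    (hJ : J.IsHomogeneous (homogeneousSubmodule (Fin (n + 1)) K)) :
    ∃ D₀, ∀ D ≥ D₀, ∀ F : MvPolynomial (Fin (n + 1)) K, F.IsHomogeneous D → θ F ∈ J.map θ →
      F ∈ I ⊔ J := by
  let U : ℕ →o Submodule K A :=
    { toFun := fun D => (J.restrictScalars K ⊓ homogeneousSubmodule (Fin (n + 1)) K D).map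
        θ.toLinearMap
      monotone' := by
        intro i j hij
        rintro _ ⟨F, ⟨hFJ, hF⟩, rfl⟩
        refine ⟨ℓ ^ (j - i) * F, ⟨J.mul_mem_left _ hFJ, ?_⟩, ?_⟩
        · have := (h.isHomogeneous.pow (j - i)).mul hF
          rwa [one_mul, Nat.sub_add_cancel hij] at this
        · simp [h.map_eq_one] }
  obtain ⟨D₀, hD₀⟩ := monotone_stabilizes_iff_noetherian.2 (inferInstance : IsNoetherian K A) U
  refine ⟨D₀, fun D hD F hF hFJ => ?_⟩
  obtain ⟨E, G, hGJ, hG, hGF⟩ := h.exists_homogeneous_of_mem_map hJ hFJ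
  have hmem : θ F ∈ U D := by
    rw [← hD₀ D hD, hD₀ (max D₀ E) (le_max_left _ _)]
    exact U.monotone (le_max_right _ _) ⟨G, ⟨hGJ, hG⟩, hGF⟩
  obtain ⟨G', ⟨hGJ', hG'⟩, hGF'⟩ := hmem
  have hI : F - G' ∈ I := h.mem_of_eq_zero (hF.sub hG') <| by
    rw [map_sub, sub_eq_zero]
    exact hGF'.symm
  rw [← sub_add_cancel F G']
  exact Submodule.add_mem_sup hI hGJ'

lemma mem_interIdeal_iff [FiniteDimensional K A] (h : IsDehomogenization I θ ℓ)
    (hJ : J.IsHomogeneous (homogeneousSubmodule (Fin (n + 1)) K)) {m : ℕ}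
    {F : MvPolynomial (Fin (n + 1)) K} (hF : F.IsHomogeneous m) :
    F ∈ interIdeal I J ↔ θ F ∈ J.map θ := by
  constructor
  · intro hFs
    obtain ⟨k, hk⟩ := mem_saturate_iff.1 hFs
    have h1 := hk _ (mem_irrelevantIdeal_pow (one_mul k ▸ h.isHomogeneous.pow k))
    obtain ⟨G, hG, H, hH, hGH⟩ := Submodule.mem_sup.1 h1
    have h2 := congrArg θ hGH
    rw [map_add, h.eq_zero_of_mem G hG, zero_add, map_mul, map_pow, h.map_eq_one, one_pow,
      mul_one] at h2
    exact h2 ▸ Ideal.mem_map_of_mem θ hH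
  · intro hFJ
    obtain ⟨D, hD⟩ := h.exists_mem_sup_of_map_mem hJ
    refine mem_saturate_of_isHomogeneous (k := D) fun j hj G hG =>
      hD _ (by omega) _ (hF.mul hG) ?_
    rw [map_mul]
    exact Ideal.mul_mem_right _ _ hFJ

lemma schemeDeg_interIdeal [FiniteDimensional K A] (h : IsDehomogenization I θ ℓ) {d : ℕ}
    (hd : ∀ᶠ m : ℕ in atTop, hilbF I m = d)
    (hJ : J.IsHomogeneous (homogeneousSubmodule (Fin (n + 1)) K)) :
    schemeDeg (interIdeal I J) = Module.finrank K (A ⧸ J.map θ) := by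
  refine schemeDeg_eq ((h.eventually_pow_eq_top hd).mono fun m hm => ?_)
  have h1 : hilbF (interIdeal I J) m = Module.finrank K
      ((homogeneousSubmodule (Fin (n + 1)) K m).map
        ((Ideal.Quotient.mkₐ K (J.map θ)).toLinearMap ∘ₗ θ.toLinearMap)) := by
    refine finrank_map_eq_of_ker fun F hF => ?_
    change Ideal.Quotient.mk _ F = 0 ↔ Ideal.Quotient.mk _ (θ F) = 0
    rw [Ideal.Quotient.eq_zero_iff_mem, Ideal.Quotient.eq_zero_iff_mem]
    exact h.mem_interIdeal_iff hJ hF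
  rw [h1, Submodule.map_comp, map_homogeneousSubmodule, hm, Submodule.map_top,
    LinearMap.range_eq_top.2 (Ideal.Quotient.mkₐ_surjective K _), finrank_top]

end IsDehomogenization

end SchemeDegree

section GeneralPosition

variable {K : Type} [Field K] {A : Type} [CommRing A] [Algebra K A] {n d : ℕ}
  {I : Ideal (MvPolynomial (Fin (n + 1)) K)} {θ : MvPolynomial (Fin (n + 1)) K →ₐ[K] A}
  {ℓ : MvPolynomial (Fin (n + 1)) K}

instance finiteDimensional_homogeneousSubmodule (m : ℕ) :
    FiniteDimensional K (homogeneousSubmodule (Fin (n + 1)) K m) :=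
  Module.Finite.iff_fg.2 (homogeneousSubmodule_fg _ _ m)

lemma finrank_homogeneousSubmodule_one :
    Module.finrank K (homogeneousSubmodule (Fin (n + 1)) K 1) = n + 1 := by
  rw [homogeneousSubmodule_one_eq_span_X, finrank_span_eq_card (linearIndependent_X _ K),
    Fintype.card_fin]

/-- In linearly general position, a proper nonempty linear section by `s` independent forms has
length at most `n + 1 - s`. -/
lemma IsDehomogenization.finrank_quotient_add_le [FiniteDimensional K A]
    (h : IsDehomogenization I θ ℓ) (hd : ∀ᶠ m : ℕ in atTop, hilbF I m = d)
    (hI : ∀ t < n, ¬ HasSecantPlane I t) {W : Submodule K (MvPolynomial (Fin (n + 1)) K)}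
    (hW : W ≤ homogeneousSubmodule (Fin (n + 1)) K 1) (h0 : 1 ≤ Module.finrank K W)
    (hWn : Module.finrank K W ≤ n) :
    Module.finrank K (A ⧸ (Ideal.span (W : Set (MvPolynomial (Fin (n + 1)) K))).map θ) +
      Module.finrank K W ≤ n + 1 := by
  by_contra! hlt
  refine hI (n - Module.finrank K W) (by omega) ⟨_, ⟨W, hW, by omega, rfl⟩, ?_⟩
  rw [h.schemeDeg_interIdeal hd (Ideal.homogeneous_span _ _ fun x hx => ⟨1, hW hx⟩)]
  omega

lemma IsDehomogenization.isLGP [FiniteDimensional K A] (h : IsDehomogenization I θ ℓ)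
    (hd : ∀ᶠ m : ℕ in atTop, hilbF I m = d) (hn : 1 ≤ n) (hnd : n + 1 ≤ d)
    (hI : ∀ t < n, ¬ HasSecantPlane I t) : IsLGP (linearForms θ) n := by
  have hA : Module.finrank K A = d := h.finrank_eq hd
  have hinj : ∀ f ∈ homogeneousSubmodule (Fin (n + 1)) K 1, θ f = 0 → f = 0 := by
    intro f hf hf0
    by_contra hne
    have h1 : Module.finrank K (Submodule.span K {f}) = 1 := finrank_span_singleton hne
    have h2 := h.finrank_quotient_add_le hd hI ((Submodule.span_singleton_le_iff_mem _ _).2 hf)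
      h1.ge (h1.trans_le hn)
    have h3 : (Ideal.span (Submodule.span K {f} : Set (MvPolynomial (Fin (n + 1)) K))).map θ =
        ⊥ := by
      refine eq_bot_iff.2 (Ideal.map_le_iff_le_comap.2 (Ideal.span_le.2 fun x hx => ?_))
      obtain ⟨c, rfl⟩ := Submodule.mem_span_singleton.1 hx
      simp [hf0]
    have h4 := finrank_quotient_add_finrank_ideal (K := K) (⊥ : Ideal A)
    rw [Submodule.restrictScalars_bot, finrank_bot] at h4
    rw [h3] at h2
    omega
  have hmap {W : Submodule K (MvPolynomial (Fin (n + 1)) K)}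
      (hW : W ≤ homogeneousSubmodule (Fin (n + 1)) K 1) :
      Module.finrank K (W.map θ.toLinearMap) = Module.finrank K W := by
    rw [finrank_map_eq_of_ker (g := LinearMap.id) fun x hx => ⟨hinj x (hW hx), fun hx0 => by
      rw [show x = 0 from hx0, map_zero]⟩, Submodule.map_id]
  have hV : Module.finrank K (linearForms θ) = n + 1 :=
    (hmap le_rfl).trans finrank_homogeneousSubmodule_one
  refine ⟨h.one_mem, hV, fun B => ?_⟩
  set W := homogeneousSubmodule (Fin (n + 1)) K 1 ⊓ (B.comap θ).restrictScalars K with hW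
  have hW1 : W ≤ homogeneousSubmodule (Fin (n + 1)) K 1 := inf_le_left
  have hVB : linearForms θ ⊓ B.restrictScalars K = W.map θ.toLinearMap := by
    refine le_antisymm ?_ ?_
    · rintro _ ⟨⟨f, hf, rfl⟩, hfB⟩
      exact ⟨f, ⟨hf, hfB⟩, rfl⟩
    · rintro _ ⟨f, ⟨hf, hfB⟩, rfl⟩
      exact ⟨⟨f, hf, rfl⟩, hfB⟩
  have : FiniteDimensional K W := Submodule.finiteDimensional_of_le hW1
  have hle := Submodule.finrank_mono hW1
  rw [finrank_homogeneousSubmodule_one] at hle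
  rcases Nat.eq_zero_or_pos (Module.finrank K W) with h0 | hpos
  · left
    rw [hVB, Submodule.finrank_eq_zero.1 h0, Submodule.map_bot]
  right
  rcases hle.eq_or_lt with heq | hlt
  · have hWeq : W = homogeneousSubmodule (Fin (n + 1)) K 1 :=
      Submodule.eq_of_le_of_finrank_eq hW1 (heq.trans finrank_homogeneousSubmodule_one.symm)
    have hB : B = ⊤ := by
      have hℓ : ℓ ∈ W := hWeq ▸ h.isHomogeneous
      exact (Ideal.eq_top_iff_one _).2 (h.map_eq_one ▸ hℓ.2)
    rw [hB, Submodule.restrictScalars_top, sup_top_eq]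
  · have h1 := h.finrank_quotient_add_le hd hI hW1 hpos (by omega)
    have h2 := finrank_quotient_le_of_le (K := K)
      (N := (Ideal.span (W : Set (MvPolynomial (Fin (n + 1)) K))).map θ) (B := B)
      (Ideal.map_le_iff_le_comap.2 (Ideal.span_le.2 fun x hx => hx.2))
    have h3 := finrank_quotient_add_finrank_ideal (K := K) B
    have h4 := Submodule.finrank_sup_add_finrank_inf_eq (linearForms θ) (B.restrictScalars K)
    rw [hVB, hmap hW1, hV] at h4
    refine Submodule.eq_top_of_finrank_eq (le_antisymm (Submodule.finrank_le _) ?_)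
    omega

/-- A finite scheme in linearly general position which fails to be `q`-normal meets a rational
normal curve in at least `n q + 2` points, if its degree is small compared to `q`. -/
lemma le_rhoInv [IsAlgClosed K] (hn : 1 ≤ n) (hfin : IsFiniteSubscheme I)
    (hd : ∀ᶠ m : ℕ in atTop, hilbF I m = d) (hnd : n + 1 ≤ d)
    (hI : ∀ t < n, ¬ HasSecantPlane I t) {q m : ℕ} (hqm : q ≤ m) (hm : hilbF I m ≠ d)
    (hq : d * (2 * n + 2) + n * (2 * n + 3) ≤ q * (n * (2 * n + 3)) + (2 * n + 2)) :
    n * q + 2 ≤ rhoInv I := by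
  have : Infinite K := IsAlgClosed.instInfinite
  obtain ⟨A, _, _, θ, ℓ, h⟩ := exists_isDehomogenization hfin.homog hfin.saturated
  have := h.finiteDimensional hd
  have hA : Module.finrank K A = d := h.finrank_eq hd
  have hV := h.isLGP hd hn hnd hI
  have hlt : linearForms θ ^ q < ⊤ := by
    refine lt_top_iff_ne_top.2 fun htop => hm ?_
    rw [h.hilbF_eq, top_le_iff.1 (htop.symm.trans_le (h.pow_mono hqm)), finrank_top, hA]
  obtain ⟨φ, hφ, hqφ⟩ := Submodule.exists_le_ker_of_lt_top _ hlt
  have hcod (B : Ideal A) : Module.finrank K (A ⧸ B) ≤ d := by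
    have := finrank_quotient_add_finrank_ideal (K := K) B
    omega
  obtain ⟨v, hv, hvi, hvm⟩ := hV.exists_normal_basis_of_le hn hφ hqφ <|
    le_trans (Nat.add_le_add_right (Nat.mul_le_mul_right _ (hcod _)) _) hq
  have hspan : Submodule.span K (Set.range fun i : Fin (n + 1) => v i) = linearForms θ := by
    refine Submodule.eq_of_le_of_finrank_eq (Submodule.span_le.2 ?_) ?_
    · rintro _ ⟨i, rfl⟩
      exact hv i
    · rw [finrank_span_eq_card hvi, Fintype.card_fin, hV.finrank_eq]
  obtain ⟨J, hJ, hJφ⟩ := exists_isRNC_map_le hn θ hvi hspan h.one_mem hvm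
  have hbdd : BddAbove {e : ℕ | ∃ J : Ideal (MvPolynomial (Fin (n + 1)) K),
      IsRNC n J ∧ e = schemeDeg (interIdeal I J)} := by
    refine ⟨d, ?_⟩
    rintro _ ⟨J, hJ, rfl⟩
    rw [h.schemeDeg_interIdeal hd (hJ.isHomogeneous hn)]
    exact hcod _
  calc n * q + 2 ≤ Module.finrank K (A ⧸ annF φ) := hV.le_finrank hφ hqφ
    _ ≤ Module.finrank K (A ⧸ J.map θ) := finrank_quotient_le_of_le hJφ
    _ = schemeDeg (interIdeal I J) := (h.schemeDeg_interIdeal hd (hJ.isHomogeneous hn)).symm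
    _ ≤ rhoInv I := le_csSup hbdd ⟨J, hJ, rfl⟩

end GeneralPosition

/-- part of Theorem 1.4. -/
theorem stmt1 (K : Type) [Field K] [IsAlgClosed K] [CharZero K] (n d : ℕ) (hn : 2 ≤ n)
    (I : Ideal (MvPolynomial (Fin (n+1)) K))
    (hfin : IsFiniteSubscheme I) (hlgp : InLinGenPos I) (hdeg : schemeDeg I = d)
    (hd : 4*n^2 + 6*n + 1 ≤ d)
    (hreg : ⌈((d : ℚ) - 1) / ((n : ℚ) + (n : ℚ) / (2*(n : ℚ) + 2))⌉ + 3 ≤ (schemeReg I : ℤ))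
    (m : ℤ) (hm : m = ⌈((d : ℚ) - 1) / (n : ℚ)⌉ + 1 - (schemeReg I : ℤ)) :
    (d : ℤ) - (m + 1) * n < (rhoInv I : ℤ) := by
  have hev : ∀ᶠ m : ℕ in atTop, hilbF I m = d := by
    obtain ⟨e, -, he⟩ := hfin.finite
    rwa [← hdeg, schemeDeg_eq he]
  have hI : ∀ t < n, ¬ HasSecantPlane I t := fun t ht =>
    Nat.notMem_of_lt_sInf (ht.trans_eq hlgp.symm)
  have hn0 : (0 : ℚ) < n := by exact_mod_cast (by omega : 0 < n)
  have hd1 : (1 : ℚ) ≤ d := by exact_mod_cast (by omega : 1 ≤ d)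
  have hden : (0 : ℚ) < (n : ℚ) + (n : ℚ) / (2*(n : ℚ) + 2) := by positivity
  have hr3 : 3 ≤ schemeReg I := by
    have : 0 ≤ ⌈((d : ℚ) - 1) / ((n : ℚ) + (n : ℚ) / (2*(n : ℚ) + 2))⌉ :=
      Int.ceil_nonneg (div_nonneg (by linarith) hden.le)
    omega
  obtain ⟨q, hr⟩ := Nat.exists_eq_add_of_le' (show 2 ≤ schemeReg I by omega)
  have hq : d * (2 * n + 2) + n * (2 * n + 3) ≤ q * (n * (2 * n + 3)) + (2 * n + 2) := by
    have h1 : ((d : ℚ) - 1) / ((n : ℚ) + (n : ℚ) / (2*(n : ℚ) + 2)) ≤ (q : ℚ) - 1 := by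
      refine (Int.le_ceil _).trans ?_
      have : ⌈((d : ℚ) - 1) / ((n : ℚ) + (n : ℚ) / (2*(n : ℚ) + 2))⌉ ≤ (q : ℤ) - 1 := by omega
      exact_mod_cast this
    rw [div_le_iff₀ hden] at h1
    have h2 := mul_le_mul_of_nonneg_right h1 (show (0 : ℚ) ≤ 2 * n + 2 by positivity)
    have h3 : ((n : ℚ) + (n : ℚ) / (2*(n : ℚ) + 2)) * (2 * n + 2) = n * (2 * n + 3) := by
      field_simp
      ring
    rw [mul_assoc, h3] at h2
    have h4 : (d : ℚ) * (2 * n + 2) + n * (2 * n + 3) ≤ q * (n * (2 * n + 3)) + (2 * n + 2) := by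
      linarith
    exact_mod_cast h4
  have hne : ∃ k, q ≤ k ∧ hilbF I k ≠ d := by
    by_contra! hall
    have h1 : q + 1 ∉ {p : ℕ | 1 ≤ p ∧ ∀ m : ℕ, p - 1 ≤ m → hilbF I m = schemeDeg I} :=
      Nat.notMem_of_lt_sInf (show q + 1 < schemeReg I by omega)
    exact h1 ⟨by omega, fun k hk => hdeg ▸ hall k hk⟩
  obtain ⟨k, hqk, hk⟩ := hne
  have hrho := le_rhoInv (by omega) hfin hev (by nlinarith) hI hqk hk hq
  have hceil : (d : ℤ) - 1 ≤ ⌈((d : ℚ) - 1) / (n : ℚ)⌉ * n := by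
    have := (div_le_iff₀ hn0).1 (Int.le_ceil (((d : ℚ) - 1) / (n : ℚ)))
    exact_mod_cast this
  have hrho' : (n : ℤ) * q + 2 ≤ rhoInv I := by exact_mod_cast hrho
  rw [hm, hr]
  push_cast
  nlinarith
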